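/- arXiv:1103.0600 — 2 statements merged into one kernel-verified Lean document; each statement's English description precedes it below -/
import Mathlib

section
/- In an extensive category, a commutative cube whose bottom face is the pushout square (f, inl : C → C+X, inl : B → B+X, f + id_X) and whose back and left faces are pullbacks has the property that its top face is a pushout if and only if its front and right faces are pullbacks. Consequently every extensive category with pullbacks in which all monomorphisms are coproduct injections is adhesive. -/
open CategoryTheory CategoryTheory.Limits

/-- A span one of whose legs is a coproduct injection has a pushout, whose apex is a coproduct of
the other target with the complementary summand. -/
theorem hasPushout_of_isColimit_binaryCofan {𝒞 : Type*} [Category* 𝒞] [HasBinaryCoproducts 𝒞]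
    {X Y Z S : 𝒞} {f : S ⟶ X} {j : Z ⟶ X} (hc : IsColimit (BinaryCofan.mk f j)) (g : S ⟶ Y) :
    HasPushout f g := by
  let d : X ⟶ Z ⨿ Y := BinaryCofan.IsColimit.desc hc (g ≫ coprod.inr) coprod.inl
  have hl : f ≫ d = g ≫ coprod.inr := BinaryCofan.IsColimit.inl_desc hc _ _
  have hr : j ≫ d = coprod.inl := BinaryCofan.IsColimit.inr_desc hc _ _
  have H : IsPushout g f coprod.inr d :=
    (is_coprod_iff_isPushout (BinaryCofan.mk f j) hc ⟨hl.symm⟩).1 <| by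
      change Nonempty (IsColimit (BinaryCofan.mk (j ≫ d) coprod.inr))
      rw [hr]
      exact ⟨coprodIsCoprod Z Y⟩
  exact H.flip.hasPushout

/-- In an extensive category, the pushout square of `f : C ⟶ B` along a coproduct injection
`C ⟶ C ⨿ X` (with bottom `f ⨿ 𝟙 X` and right leg the coproduct injection) is a van Kampen
square: in any commutative cube over it with back and left faces pullbacks, the top face is a
pushout iff the front and right faces are pullbacks.  Consequently, every extensive category
with pullbacks in which every monomorphism is a coproduct injection is adhesive. -/
theorem extensive_vanKampen_and_adhesive {𝒞 : Type u} [Category.{v} 𝒞] [FinitaryExtensive 𝒞]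
    [HasPullbacks 𝒞] :
    (∀ {C B : 𝒞} (f : C ⟶ B) (X : 𝒞)
      (H : IsPushout f (coprod.inl : C ⟶ C ⨿ X) (coprod.inl : B ⟶ B ⨿ X)
        (coprod.map f (𝟙 X))), H.IsVanKampen) ∧
    ((∀ (X Y : 𝒞) (i : X ⟶ Y), Mono i →
        ∃ (Z : 𝒞) (j : Z ⟶ Y), Nonempty (IsColimit (BinaryCofan.mk i j))) →
      Adhesive 𝒞) := by
  refine ⟨fun {C B} f X H ↦
    H.isVanKampen_inl (BinaryCofan.mk coprod.inl coprod.inr) (coprodIsCoprod C X), fun h ↦ ?_⟩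
  refine @Adhesive.mk _ _ (fun _ _ _ ↦ inferInstance) (fun f g _ ↦ ?_) fun {_ _ _ _ f _ _ _} _ H ↦ ?_
  · obtain ⟨_, _, ⟨hc⟩⟩ := h _ _ f inferInstance
    exact hasPushout_of_isColimit_binaryCofan hc g
  · obtain ⟨_, j, ⟨hc⟩⟩ := h _ _ f inferInstance
    exact (H.flip.isVanKampen_inl (BinaryCofan.mk f j) hc).flip
end

section
/- (Lemma 4 of the paper) In an adhesive category, given a monomorphism m : C → A and a map f : C → B, form the pushout D of f along m with legs g : A → D and n : B → D; let (g₁,g₂) : A₂ ⇉ A be the kernel pair of g and (f₁,f₂) : C₂ ⇉ C the kernel pair of f, with diagonal maps γ : C → C₂ and δ : A → A₂. Then the square with top γ, left m, right m₂ (the induced map C₂ → A₂), bottom δ is both a pushout and a pullback. -/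
open CategoryTheory CategoryTheory.Limits

/-- In an adhesive category, the map induced on a pushout over the intersection of two
monomorphisms is a monomorphism. -/
theorem CategoryTheory.Adhesive.mono_of_isPullback_of_isPushout {𝒞 : Type u} [Category.{v} 𝒞]
    [Adhesive 𝒞] {W X Y Z P : 𝒞} {p : W ⟶ X} {q : W ⟶ Y} {a : X ⟶ Z} {b : Y ⟶ Z} [Mono a] [Mono b]
    (hW : IsPullback p q a b) {i : X ⟶ P} {j : Y ⟶ P} (hP : IsPushout p q i j)
    (k : P ⟶ Z) (hi : i ≫ k = a) (hj : j ≫ k = b) : Mono k := by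
  have hQ : IsPushout p q (pushout.inl (pullback.fst a b) (pullback.snd a b))
      (pushout.inr (pullback.fst a b) (pullback.snd a b)) :=
    (IsPushout.of_hasPushout (pullback.fst a b) (pullback.snd a b)).of_iso hW.isoPullback.symm
      (Iso.refl _) (Iso.refl _) (Iso.refl _) (by simp) (by simp) (by simp) (by simp)
  have hk : k = (hP.isoIsPushout _ _ hQ).hom ≫ pushout.desc a b pullback.condition :=
    hP.hom_ext (by rw [hi, IsPushout.inl_isoIsPushout_hom_assoc, pushout.inl_desc])
      (by rw [hj, IsPushout.inr_isoIsPushout_hom_assoc, pushout.inr_desc])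
  rw [hk]
  infer_instance

/-- In an adhesive category, a monomorphism under `W` that becomes an isomorphism after pushing out
along a morphism `q` out of `W` is itself an isomorphism. -/
theorem CategoryTheory.Adhesive.isIso_of_mono_of_isPushout {𝒞 : Type u} [Category.{v} 𝒞]
    [Adhesive 𝒞] {W P X Y Z : 𝒞} {i : W ⟶ P} {p : W ⟶ X} [Mono p] {q : W ⟶ Y} {h : X ⟶ Z}
    {j : Y ⟶ Z} (k : P ⟶ X) [Mono k] (hik : i ≫ k = p) (hX : IsPushout p q h j)
    (hP : IsPushout i q (k ≫ h) j) : IsIso k := by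
  have hback : IsPullback i (𝟙 W) k p :=
    IsPullback.of_isLimit' ⟨by simp [hik]⟩ (PullbackCone.IsLimit.mk _ (fun s => s.snd)
      (fun s => by rw [← cancel_mono k, Category.assoc, hik, s.condition])
      (fun s => by simp) (fun s l _ hl => by simpa using hl))
  have hfront := ((Adhesive.van_kampen hX i q (k ≫ h) j (𝟙 W) k (𝟙 Y) (𝟙 Z) hback
    (IsPullback.of_vert_isIso ⟨by simp⟩) ⟨by simp⟩ ⟨by simp⟩ hP.toCommSq).1 hP).1
  exact hfront.isIso_snd_of_isIso

/-- Lemma 4 of the paper.  In an adhesive category, given a monomorphism `m : C ⟶ A` and a map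
`f : C ⟶ B`, form the pushout `D` with legs `g : A ⟶ D`, `n : B ⟶ D`; let `(g₁, g₂)` be the
kernel pair of `g`, `(f₁, f₂)` the kernel pair of `f`, with diagonals `γ : C ⟶ C₂` and
`δ : A ⟶ A₂`, and `m₂ : C₂ ⟶ A₂` the induced map.  Then the square with top `γ`, left `m`,
right `m₂` and bottom `δ` is both a pushout and a pullback. -/
theorem adhesive_kernelPair_square {𝒞 : Type u} [Category.{v} 𝒞] [Adhesive 𝒞]
    {C A B D C₂ A₂ : 𝒞} (m : C ⟶ A) (f : C ⟶ B) [Mono m]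
    (g : A ⟶ D) (n : B ⟶ D) (H : IsPushout m f g n)
    (f₁ f₂ : C₂ ⟶ C) (hf : IsPullback f₁ f₂ f f)
    (g₁ g₂ : A₂ ⟶ A) (hg : IsPullback g₁ g₂ g g)
    (γ : C ⟶ C₂) (hγ₁ : γ ≫ f₁ = 𝟙 C) (hγ₂ : γ ≫ f₂ = 𝟙 C)
    (δ : A ⟶ A₂) (hδ₁ : δ ≫ g₁ = 𝟙 A) (hδ₂ : δ ≫ g₂ = 𝟙 A)
    (m₂ : C₂ ⟶ A₂) (hm₁ : m₂ ≫ g₁ = f₁ ≫ m) (hm₂ : m₂ ≫ g₂ = f₂ ≫ m) :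
    IsPushout γ m m₂ δ ∧ IsPullback γ m m₂ δ := by
  have hDpb : IsPullback m f g n := Adhesive.isPullback_of_isPushout_of_mono_left H
  have hm₂pb : IsPullback m₂ f₁ g₁ m :=
    IsPullback.of_right (by rw [hm₂, H.w]; exact hf.flip.paste_horiz hDpb) hm₁ hg.flip
  have hA : IsPushout m₂ f₂ g₂ m :=
    (Adhesive.van_kampen H m₂ f₂ g₂ m f₁ g₁ f g hm₂pb hf.flip ⟨hg.w.symm⟩ ⟨H.w⟩ ⟨hm₂⟩).2
      ⟨hg.flip, hDpb⟩
  have : Mono m₂ := hm₂pb.mono_fst_of_mono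
  have : Mono γ := mono_of_mono_fac hγ₁
  have : Mono δ := mono_of_mono_fac hδ₁
  have w : γ ≫ m₂ = m ≫ δ := hg.hom_ext
    (by simp [hm₁, hδ₁, reassoc_of% hγ₁]) (by simp [hm₂, hδ₂, reassoc_of% hγ₂])
  have hpb : IsPullback γ m m₂ δ :=
    IsPullback.of_right (by rw [hγ₂, hδ₂]; exact IsPullback.of_horiz_isIso ⟨by simp⟩) w
      (Adhesive.isPullback_of_isPushout_of_mono_left hA).flip
  have hP := IsPushout.of_hasPushout γ m
  let k := pushout.desc m₂ δ w
  have hk₁ : pushout.inl γ m ≫ k = m₂ := pushout.inl_desc ..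
  have hk₂ : pushout.inr γ m ≫ k = δ := pushout.inr_desc ..
  have : Mono k := Adhesive.mono_of_isPullback_of_isPushout hpb hP k hk₁ hk₂
  have hPA : IsPushout (pushout.inl γ m) f₂ (k ≫ g₂) m := by
    refine (IsPushout.of_left (h₁₁ := γ) (h₂₁ := pushout.inr γ m) ?_ ?_ hP).flip
    · rw [hγ₂, reassoc_of% hk₂, hδ₂]
      exact IsPushout.of_horiz_isIso ⟨by simp⟩
    · rw [reassoc_of% hk₁, hm₂]
  have : IsIso k := Adhesive.isIso_of_mono_of_isPushout k hk₁ hA hPA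
  exact ⟨hP.of_iso (Iso.refl _) (Iso.refl _) (Iso.refl _) (asIso k) (by simp) (by simp)
    (by simp [hk₁]) (by simp [hk₂]), hpb⟩
end
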